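/- For all n ≥ 5: t_n^3(213) = 2n + 1, t_n^4(213) = n + 4, and t_n^k(213) = 7 for every k ≥ 5, where t_n^k(213) counts the permutations π ∈ S_n such that π, θ(π), θ²(π), …, θ^k(π) all avoid the pattern 213. -/

import Mathlib

/-- The one-line word of the image of `π` under the fundamental bijection:
write `π` in standard cycle form (every cycle written with its largest element
first, cycles listed in increasing order of their largest elements) and erase
the parentheses.  The cycle maxima are exactly the `x` with `π^[k] x ≤ x` for
all `k`, and the cycle of `x` is `x, π x, π² x, …` up to the period of `x`. -/
noncomputable def fundWord {n : ℕ} (π : Equiv.Perm (Fin n)) : List (Fin n) :=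
  ((List.finRange n).filter fun x => (List.range n).all fun k => decide ((⇑π)^[k] x ≤ x)).flatMap
    fun x => (List.range (Function.minimalPeriod (⇑π) x)).map fun k => (⇑π)^[k] x

/-- The permutation whose one-line notation is the word `w`
(junk value if `w` is not the one-line notation of a permutation). -/
noncomputable def permOfWord {n : ℕ} (w : List (Fin n)) : Equiv.Perm (Fin n) :=
  Function.invFun (fun σ : Equiv.Perm (Fin n) => (List.finRange n).map ⇑σ) w

/-- The fundamental bijection `θ`. -/
noncomputable def theta {n : ℕ} (π : Equiv.Perm (Fin n)) : Equiv.Perm (Fin n) :=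
  permOfWord (fundWord π)

/-- `π` contains the pattern `σ`. -/
def Contains {k n : ℕ} (σ : Equiv.Perm (Fin k)) (π : Equiv.Perm (Fin n)) : Prop :=
  ∃ f : Fin k → Fin n, StrictMono f ∧ ∀ a b : Fin k, π (f a) < π (f b) ↔ σ a < σ b

/-- `π` avoids the pattern `σ`. -/
def Avoids {k n : ℕ} (π : Equiv.Perm (Fin n)) (σ : Equiv.Perm (Fin k)) : Prop :=
  ¬ Contains σ π

noncomputable def p123 : Equiv.Perm (Fin 3) := Equiv.ofBijective ![0, 1, 2] (by decide)
noncomputable def p132 : Equiv.Perm (Fin 3) := Equiv.ofBijective ![0, 2, 1] (by decide)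
noncomputable def p213 : Equiv.Perm (Fin 3) := Equiv.ofBijective ![1, 0, 2] (by decide)
noncomputable def p231 : Equiv.Perm (Fin 3) := Equiv.ofBijective ![1, 2, 0] (by decide)
noncomputable def p312 : Equiv.Perm (Fin 3) := Equiv.ofBijective ![2, 0, 1] (by decide)
noncomputable def p321 : Equiv.Perm (Fin 3) := Equiv.ofBijective ![2, 1, 0] (by decide)

/-- The direct sum `π ⊕ τ` of two permutations. -/
def directSum {n m : ℕ} (π : Equiv.Perm (Fin n)) (τ : Equiv.Perm (Fin m)) :
    Equiv.Perm (Fin (n + m)) :=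
  finSumFinEquiv.permCongr (Equiv.sumCongr π τ)

/-- A permutation is irreducible if it is not a direct sum of two nonempty permutations. -/
def IrreduciblePerm {n : ℕ} (π : Equiv.Perm (Fin n)) : Prop :=
  ¬ ∃ (a b : ℕ) (_ : 0 < a) (_ : 0 < b) (h : a + b = n)
      (σ : Equiv.Perm (Fin a)) (τ : Equiv.Perm (Fin b)),
      π = (finCongr h).permCongr (directSum σ τ)

/-- A permutation is cyclic if its cycle decomposition is a single cycle of full length,
i.e. it acts transitively. -/
def IsCyclicPerm {n : ℕ} (π : Equiv.Perm (Fin n)) : Prop :=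
  ∀ x y : Fin n, ∃ k : ℕ, (⇑π)^[k] x = y

/-- `IsTheta π σ` says that `π` is recovered from the word of `σ`: each letter is sent to the next
one if that is not a left-to-right maximum, and to the largest letter so far otherwise. -/
def IsTheta {n : ℕ} (π σ : Equiv.Perm (Fin n)) : Prop :=
  ∀ i : Fin n,
    (∃ j : Fin n, j.val = i.val + 1 ∧ (∃ l ≤ i, σ j < σ l) ∧ π (σ i) = σ j) ∨
    ((∀ j : Fin n, j.val = i.val + 1 → ∀ l ≤ i, σ l < σ j) ∧
      ∃ l ≤ i, π (σ i) = σ l ∧ ∀ l' ≤ i, σ l' ≤ σ l)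

theorem IsTheta.left_unique {n : ℕ} {π π' σ : Equiv.Perm (Fin n)}
    (h : IsTheta π σ) (h' : IsTheta π' σ) : π = π' := by
  ext1 x
  obtain ⟨i, rfl⟩ := σ.surjective x
  rcases h i with ⟨j, hj, ⟨l, hl, hlt⟩, e⟩ | ⟨hj, l, hl, e, hmax⟩ <;>
    rcases h' i with ⟨j', hj', ⟨l', hl', hlt'⟩, e'⟩ | ⟨hj', l', hl', e', hmax'⟩
  · have : j = j' := Fin.ext (by omega)
    rw [e, e', this]
  · exact absurd (hj' j hj l hl) hlt.asymm
  · exact absurd (hj j' hj' l' hl') hlt'.asymm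
  · rw [e, e', le_antisymm (hmax' l hl) (hmax l' hl')]

section FundamentalWord

variable {n : ℕ} (π : Equiv.Perm (Fin n))

noncomputable def cycleWord (x : Fin n) : List (Fin n) :=
  (List.range (Function.minimalPeriod (⇑π) x)).map fun k => (⇑π)^[k] x

def cycleMaxima : List (Fin n) :=
  (List.finRange n).filter fun x => (List.range n).all fun k => decide ((⇑π)^[k] x ≤ x)

theorem minimalPeriod_perm_pos (x : Fin n) : 0 < Function.minimalPeriod (⇑π) x :=
  Function.minimalPeriod_pos_of_mem_periodicPts (π.injective.mem_periodicPts x)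

theorem minimalPeriod_perm_le (x : Fin n) : Function.minimalPeriod (⇑π) x ≤ n := by
  have h := Finset.card_le_card_of_injOn (s := Finset.range (Function.minimalPeriod (⇑π) x))
    (t := Finset.univ) (fun k => (⇑π)^[k] x) (by simp)
    (by simpa using Function.iterate_injOn_Iio_minimalPeriod)
  simpa using h

theorem mem_cycleMaxima {x : Fin n} :
    x ∈ cycleMaxima π ↔ ∀ k, (⇑π)^[k] x ≤ x := by
  simp only [cycleMaxima, List.mem_filter, List.mem_finRange, true_and, List.all_eq_true,
    List.mem_range, decide_eq_true_eq]
  refine ⟨fun h k => ?_, fun h k _ => h k⟩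
  rw [← Function.iterate_mod_minimalPeriod_eq]
  exact h _ ((Nat.mod_lt _ (minimalPeriod_perm_pos π x)).trans_le (minimalPeriod_perm_le π x))

theorem mem_cycleWord {x y : Fin n} : y ∈ cycleWord π x ↔ ∃ k, (⇑π)^[k] x = y := by
  simp only [cycleWord, List.mem_map, List.mem_range]
  refine ⟨fun ⟨k, _, h⟩ => ⟨k, h⟩, fun ⟨k, h⟩ => ⟨k % Function.minimalPeriod (⇑π) x,
    Nat.mod_lt _ (minimalPeriod_perm_pos π x), ?_⟩⟩
  rw [Function.iterate_mod_minimalPeriod_eq, h]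

theorem exists_iterate_eq_symm {x y : Fin n} (h : ∃ k, (⇑π)^[k] x = y) :
    ∃ k, (⇑π)^[k] y = x := by
  obtain ⟨k, rfl⟩ := h
  have hp := minimalPeriod_perm_pos π x
  refine ⟨k * (Function.minimalPeriod (⇑π) x - 1), ?_⟩
  rw [← Function.iterate_add_apply]
  have : k * (Function.minimalPeriod (⇑π) x - 1) + k = k * Function.minimalPeriod (⇑π) x := by
    obtain ⟨p, hp'⟩ := Nat.exists_eq_add_of_lt hp
    rw [hp']; simp; ring
  rw [this]
  exact (Function.isPeriodicPt_minimalPeriod (⇑π) x).const_mul k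

theorem fundWord_eq : fundWord π = (cycleMaxima π).flatMap (cycleWord π) := rfl

theorem nodup_fundWord : (fundWord π).Nodup := by
  rw [fundWord_eq, List.nodup_flatMap]
  refine ⟨fun x _ => ?_, ?_⟩
  · refine List.Nodup.map_on ?_ List.nodup_range
    intro a ha b hb h
    exact Function.iterate_injOn_Iio_minimalPeriod (by simpa using ha) (by simpa using hb) h
  · have hnd : (cycleMaxima π).Nodup := (List.nodup_finRange n).filter _
    refine hnd.imp_of_mem ?_
    intro a b ha hb hab
    rw [Function.onFun, List.disjoint_left]
    intro y hya hyb
    rw [mem_cycleWord] at hya hyb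
    rw [mem_cycleMaxima] at ha hb
    apply hab
    obtain ⟨s, hs⟩ := hya
    obtain ⟨t, ht⟩ := hyb
    obtain ⟨s', hs'⟩ := exists_iterate_eq_symm π ⟨s, hs⟩
    obtain ⟨t', ht'⟩ := exists_iterate_eq_symm π ⟨t, ht⟩
    apply le_antisymm
    · rw [← hs', ← ht, ← Function.iterate_add_apply]; exact hb _
    · rw [← ht', ← hs, ← Function.iterate_add_apply]; exact ha _

theorem mem_fundWord (x : Fin n) : x ∈ fundWord π := by
  rw [fundWord_eq, List.mem_flatMap]
  obtain ⟨m, hm, hmax⟩ := (Set.toFinite {y | ∃ k, (⇑π)^[k] x = y}).exists_maximal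
    ⟨x, 0, rfl⟩
  refine ⟨m, (mem_cycleMaxima π).2 fun k => ?_, (mem_cycleWord π).2 (exists_iterate_eq_symm π hm)⟩
  obtain ⟨s, rfl⟩ := hm
  by_contra! hlt
  exact absurd (hmax ⟨k + s, Function.iterate_add_apply _ _ _ _⟩ hlt.le) (not_le.2 hlt)

theorem length_fundWord : (fundWord π).length = n := by
  have h := (List.perm_ext_iff_of_nodup (nodup_fundWord π) (List.nodup_finRange n)).2
    fun x => by simp [mem_fundWord]
  simpa using h.length_eq

theorem map_theta : (List.finRange n).map ⇑(theta π) = fundWord π := by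
  have hl := length_fundWord π
  let f : Fin n → Fin n := fun i => (fundWord π)[i.val]'(by omega)
  have hf : Function.Injective f := by
    intro i j hij
    have := (List.Nodup.getElem_inj_iff (nodup_fundWord π)).1 hij
    exact Fin.ext this
  have hex : ∃ σ : Equiv.Perm (Fin n), (List.finRange n).map ⇑σ = fundWord π := by
    refine ⟨Equiv.ofBijective f (Finite.injective_iff_bijective.1 hf), ?_⟩
    apply List.ext_getElem
    · simp [hl]
    · intro i h1 h2
      simp [f]
  exact Function.invFun_eq hex

theorem cycleWord_eq_append {m x : Fin n} {u v : List (Fin n)}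
    (h : cycleWord π m = u ++ x :: v) :
    (v = [] ∧ π x = m) ∨ ∃ y v', v = y :: v' ∧ π x = y := by
  have hlen := congrArg List.length h
  simp only [cycleWord, List.length_map, List.length_range, List.length_append,
    List.length_cons] at hlen
  have hget : ∀ k (hk : k < (u ++ x :: v).length), (u ++ x :: v)[k] = (⇑π)^[k] m := by
    intro k hk
    simp only [← h, cycleWord, List.getElem_map, List.getElem_range]
  have hx : x = (⇑π)^[u.length] m := by
    rw [← hget u.length (by simp)]; simp
  rcases v with _ | ⟨y, v'⟩
  · left
    refine ⟨rfl, ?_⟩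
    rw [hx, ← Function.iterate_succ_apply' (⇑π)]
    have : u.length.succ = Function.minimalPeriod (⇑π) m := by simpa using hlen.symm
    rw [this, Function.iterate_minimalPeriod]
  · right
    refine ⟨y, v', rfl, ?_⟩
    rw [hx, ← Function.iterate_succ_apply' (⇑π), ← hget (u.length + 1) (by simp)]
    simp [List.getElem_append_right]

theorem cycleWord_eq_cons (m : Fin n) :
    ∃ v, cycleWord π m = m :: v := by
  obtain ⟨p, hp⟩ := Nat.exists_eq_succ_of_ne_zero (minimalPeriod_perm_pos π m).ne'
  exact ⟨_, by rw [cycleWord, hp, List.range_succ_eq_map, List.map_cons]; rfl⟩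

theorem flatMap_cycleWord_spec : ∀ (ms : List (Fin n)) (u₀ : List (Fin n)),
    ms.Pairwise (· < ·) → (∀ m ∈ ms, ∀ k, (⇑π)^[k] m ≤ m) → (∀ z ∈ u₀, ∀ m ∈ ms, z < m) →
    ∀ u x v, ms.flatMap (cycleWord π) = u ++ x :: v →
    (∃ y v', v = y :: v' ∧ (∃ z ∈ u₀ ++ u ++ [x], y < z) ∧ π x = y) ∨
    ((∀ y v', v = y :: v' → ∀ z ∈ u₀ ++ u ++ [x], z < y) ∧
      ∃ z ∈ u₀ ++ u ++ [x], π x = z ∧ ∀ z' ∈ u₀ ++ u ++ [x], z' ≤ z)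
  | [], _, _, _, _, u, x, v, h => by simp at h
  | m :: ms, u₀, hs, hmax, hu, u, x, v, h => by
    rw [List.pairwise_cons] at hs
    have hle : ∀ z ∈ cycleWord π m, z ≤ m := by
      intro z hz
      obtain ⟨k, rfl⟩ := (mem_cycleWord π).1 hz
      exact hmax m (by simp) k
    rw [List.flatMap_cons, List.append_eq_append_iff] at h
    have key : ∀ v₁, cycleWord π m = u ++ x :: v₁ → v = v₁ ++ ms.flatMap (cycleWord π) →
        (∃ y v', v = y :: v' ∧ (∃ z ∈ u₀ ++ u ++ [x], y < z) ∧ π x = y) ∨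
        ((∀ y v', v = y :: v' → ∀ z ∈ u₀ ++ u ++ [x], z < y) ∧
          ∃ z ∈ u₀ ++ u ++ [x], π x = z ∧ ∀ z' ∈ u₀ ++ u ++ [x], z' ≤ z) := by
      intro v₁ hc hv
      have hm : m ∈ u ++ [x] := by
        obtain ⟨w, hw⟩ := cycleWord_eq_cons π m
        rw [hw] at hc
        rcases u with _ | ⟨a, u⟩ <;> simp_all
      have hlem : ∀ z ∈ u₀ ++ u ++ [x], z ≤ m := by
        intro z hz
        rw [List.append_assoc, List.mem_append] at hz
        rcases hz with hz | hz
        · exact (hu z hz m (by simp)).le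
        · apply hle; rw [hc]; simp at hz ⊢; tauto
      rcases cycleWord_eq_append π hc with ⟨rfl, hx⟩ | ⟨y, v', rfl, hx⟩
      · right
        refine ⟨?_, m, by simp at hm ⊢; tauto, hx, hlem⟩
        intro y v' hy z hz
        refine (hlem z hz).trans_lt ?_
        rcases ms with _ | ⟨m', ms⟩
        · simp [hv] at hy
        · obtain ⟨w, hw⟩ := cycleWord_eq_cons π m'
          simp only [hv, List.nil_append, List.flatMap_cons, hw, List.cons_append,
            List.cons.injEq] at hy
          rw [← hy.1]
          exact hs.1 m' (by simp)
      · left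
        refine ⟨y, v' ++ ms.flatMap (cycleWord π), by simp [hv], ⟨m, by simp at hm ⊢; tauto, ?_⟩, hx⟩
        have hy : y ∈ cycleWord π m := by rw [hc]; simp
        refine lt_of_le_of_ne (hle y hy) ?_
        rintro rfl
        have hnd : (u ++ x :: y :: v').Nodup := by
          rw [← hc]
          refine List.Nodup.map_on ?_ List.nodup_range
          intro a ha b hb h
          exact Function.iterate_injOn_Iio_minimalPeriod (by simpa using ha) (by simpa using hb) h
        have : u ++ x :: y :: v' = (u ++ [x]) ++ y :: v' := by simp
        rw [this, List.nodup_append] at hnd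
        exact hnd.2.2 y hm y (by simp) rfl
    rcases h with ⟨w, rfl, h⟩ | ⟨w, hw, h⟩
    · have ih := flatMap_cycleWord_spec ms (u₀ ++ cycleWord π m) hs.2
        (fun m' hm' => hmax m' (by simp [hm'])) (by
          intro z hz m' hm'
          rcases List.mem_append.1 hz with hz | hz
          · exact hu z hz m' (by simp [hm'])
          · exact (hle z hz).trans_lt (hs.1 m' hm')) w x v h
      simpa only [List.append_assoc] using ih
    · rcases w with _ | ⟨x', w⟩
      · have ih := flatMap_cycleWord_spec ms (u₀ ++ cycleWord π m) hs.2
          (fun m' hm' => hmax m' (by simp [hm'])) (by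
            intro z hz m' hm'
            rcases List.mem_append.1 hz with hz | hz
            · exact hu z hz m' (by simp [hm'])
            · exact (hle z hz).trans_lt (hs.1 m' hm')) [] x v (by simpa using h.symm)
        rw [List.append_nil] at hw
        simpa only [hw, List.append_nil, List.append_assoc] using ih
      · rw [List.cons_append, List.cons.injEq] at h
        obtain ⟨rfl, h⟩ := h
        exact key w hw h

theorem isTheta_theta : IsTheta π (theta π) := by
  intro i
  have hmap := map_theta π
  have hlen := length_fundWord π
  have hget : ∀ k (hk : k < n), (fundWord π)[k]'(by omega) = theta π ⟨k, hk⟩ := by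
    intro k hk
    simp [← hmap]
  have hsplit : fundWord π = (fundWord π).take i ++ theta π i :: (fundWord π).drop (i + 1) := by
    conv_lhs => rw [← List.take_append_drop i (fundWord π)]
    rw [List.drop_eq_getElem_cons (by omega), hget i i.2]
  have hmem : ∀ z, z ∈ [] ++ (fundWord π).take i ++ [theta π i] ↔ ∃ l ≤ i, theta π l = z := by
    intro z
    simp only [List.nil_append, List.mem_append, List.mem_singleton, List.mem_take_iff_getElem]
    constructor
    · rintro (⟨k, hk, rfl⟩ | rfl)
      · exact ⟨⟨k, by omega⟩, by rw [Fin.le_def]; simp; omega, (hget k (by omega)).symm⟩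
      · exact ⟨i, le_rfl, rfl⟩
    · rintro ⟨l, hl, rfl⟩
      rcases hl.lt_or_eq with hl | rfl
      · exact Or.inl ⟨l, by rw [Fin.lt_def] at hl; omega, hget l l.2⟩
      · exact Or.inr rfl
  have hs : (cycleMaxima π).Pairwise (· < ·) := (List.sortedLT_finRange n).pairwise.filter _
  rcases flatMap_cycleWord_spec π (cycleMaxima π) [] hs
    (fun m hm => (mem_cycleMaxima π).1 hm) (by simp) _ _ _ hsplit with
    ⟨y, v', hv, ⟨z, hz, hyz⟩, hy⟩ | ⟨hv, z, hz, hx, hzmax⟩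
  · left
    obtain ⟨l, hl, rfl⟩ := (hmem z).1 hz
    have hi : i.val + 1 < n := by
      by_contra hi
      rw [List.drop_of_length_le (by omega)] at hv
      simp at hv
    rw [List.drop_eq_getElem_cons (by omega), hget _ hi] at hv
    have := (List.cons.inj hv).1
    exact ⟨⟨i + 1, hi⟩, rfl, ⟨l, hl, this ▸ hyz⟩, this ▸ hy⟩
  · right
    obtain ⟨l, hl, rfl⟩ := (hmem z).1 hz
    refine ⟨fun j hj l' hl' => ?_, l, hl, hx, fun l' hl' => hzmax _ ((hmem _).2 ⟨l', hl', rfl⟩)⟩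
    have hi : i.val + 1 < n := hj ▸ j.2
    refine hv (theta π j) ((fundWord π).drop (i + 1 + 1)) ?_ _ ((hmem _).2 ⟨l', hl', rfl⟩)
    rw [List.drop_eq_getElem_cons (by omega), hget _ hi]
    congr 2
    exact Fin.ext hj.symm

end FundamentalWord

theorem theta_injective {n : ℕ} : Function.Injective (theta (n := n)) := fun π ρ h =>
  (isTheta_theta π).left_unique (h ▸ isTheta_theta ρ)

theorem theta_eq_iff {n : ℕ} {π σ : Equiv.Perm (Fin n)} : theta π = σ ↔ IsTheta π σ := by
  refine ⟨fun h => h ▸ isTheta_theta π, fun h => ?_⟩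
  obtain ⟨ρ, rfl⟩ := (Finite.injective_iff_surjective.1 theta_injective) σ
  rw [h.left_unique (isTheta_theta ρ)]

/-- Avoidance of `213`, spelled out. -/
def Avoids213 {n : ℕ} (π : Equiv.Perm (Fin n)) : Prop :=
  ∀ i j k : Fin n, i < j → j < k → π j < π i → ¬ π i < π k

theorem avoids_p213_iff {n : ℕ} {π : Equiv.Perm (Fin n)} : Avoids π p213 ↔ Avoids213 π := by
  have h0 : p213 0 = 1 := rfl
  have h1 : p213 1 = 0 := rfl
  have h2 : p213 2 = 2 := rfl
  refine ⟨fun h i j k hij hjk hji hik => h ⟨![i, j, k], ?_, ?_⟩, ?_⟩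
  · rw [Fin.strictMono_iff_lt_succ]
    intro a
    fin_cases a <;> simpa
  · intro a b
    fin_cases a <;> fin_cases b <;>
      simp [h0, h1, h2, hik, hji, hji.trans hik, hik.le, hji.le, (hji.trans hik).le]
  · rintro h ⟨f, hf, hσ⟩
    refine h (f 0) (f 1) (f 2) (hf (by decide)) (hf (by decide)) ((hσ 1 0).2 ?_) ((hσ 0 2).2 ?_)
    · rw [h0, h1]; decide
    · rw [h0, h2]; decide

/-- `T_n^k(213)`. -/
def thetaAvoiders (n k : ℕ) : Set (Equiv.Perm (Fin n)) :=
  {π | ∀ i ≤ k, Avoids213 (theta^[i] π)}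

theorem mem_thetaAvoiders_zero {n : ℕ} {π : Equiv.Perm (Fin n)} :
    π ∈ thetaAvoiders n 0 ↔ Avoids213 π := by
  simp [thetaAvoiders]

theorem mem_thetaAvoiders_succ {n k : ℕ} {π : Equiv.Perm (Fin n)} :
    π ∈ thetaAvoiders n (k + 1) ↔ Avoids213 π ∧ theta π ∈ thetaAvoiders n k := by
  refine ⟨fun h => ⟨h 0 (Nat.zero_le _), fun i hi => h (i + 1) (by omega)⟩, fun h i hi => ?_⟩
  rcases i with _ | i
  · exact h.1
  · exact h.2 i (by omega)

theorem thetaAvoiders_anti {n k l : ℕ} (h : k ≤ l) : thetaAvoiders n l ⊆ thetaAvoiders n k :=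
  fun _ hπ i hi => hπ i (hi.trans h)

theorem thetaAvoiders_eq_of_succ_eq {n k : ℕ} (h : thetaAvoiders n (k + 1) = thetaAvoiders n k) :
    ∀ l, k ≤ l → thetaAvoiders n l = thetaAvoiders n k := by
  refine Nat.le_induction rfl fun l _ ih => ?_
  rw [← h]
  ext π
  rw [mem_thetaAvoiders_succ, mem_thetaAvoiders_succ, ih]

section Decidable

instance {n : ℕ} (π : Equiv.Perm (Fin n)) : Decidable (Avoids213 π) := by
  unfold Avoids213; infer_instance

instance {n : ℕ} (π σ : Equiv.Perm (Fin n)) : Decidable (IsTheta π σ) := by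
  unfold IsTheta; infer_instance

/-- A decidable form of membership in `thetaAvoiders`. -/
def ThetaAvoider (n : ℕ) : ℕ → Equiv.Perm (Fin n) → Prop
  | 0, π => Avoids213 π
  | k + 1, π => Avoids213 π ∧ ∃ σ, IsTheta π σ ∧ ThetaAvoider n k σ

instance (n : ℕ) : ∀ (k : ℕ) (π : Equiv.Perm (Fin n)), Decidable (ThetaAvoider n k π)
  | 0, π => inferInstanceAs (Decidable (Avoids213 π))
  | k + 1, π =>
    have := instDecidableThetaAvoider n k
    inferInstanceAs (Decidable (Avoids213 π ∧ ∃ σ, IsTheta π σ ∧ ThetaAvoider n k σ))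

theorem thetaAvoider_iff {n k : ℕ} {π : Equiv.Perm (Fin n)} :
    ThetaAvoider n k π ↔ π ∈ thetaAvoiders n k := by
  induction k generalizing π with
  | zero => rw [mem_thetaAvoiders_zero]; rfl
  | succ k ih =>
    rw [mem_thetaAvoiders_succ, ← ih]
    simp only [ThetaAvoider, ← theta_eq_iff, exists_eq_left']

end Decidable

theorem ncard_thetaAvoiders_four_eq (k : ℕ) :
    (thetaAvoiders 4 k).ncard = (Finset.univ.filter (ThetaAvoider 4 k)).card := by
  rw [← Set.ncard_coe_finset]
  congr 1
  ext π
  simp [thetaAvoider_iff]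

theorem ncard_thetaAvoiders_four_three : (thetaAvoiders 4 3).ncard = 9 := by
  rw [ncard_thetaAvoiders_four_eq]
  decide +kernel

theorem ncard_thetaAvoiders_four_four : (thetaAvoiders 4 4).ncard = 8 := by
  rw [ncard_thetaAvoiders_four_eq]
  decide +kernel

theorem ncard_thetaAvoiders_four {k : ℕ} (hk : 5 ≤ k) : (thetaAvoiders 4 k).ncard = 7 := by
  have h5 : (thetaAvoiders 4 5).ncard = 7 := by
    rw [ncard_thetaAvoiders_four_eq]
    decide +kernel
  have h6 : (thetaAvoiders 4 6).ncard = 7 := by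
    rw [ncard_thetaAvoiders_four_eq]
    decide +kernel
  rw [thetaAvoiders_eq_of_succ_eq (Set.eq_of_subset_of_ncard_le
    (thetaAvoiders_anti (Nat.le_succ 5)) (h5.trans h6.symm).le (Set.toFinite _)) k hk, h5]

/-- `f` permutes `{0, …, m}` and avoids `213`. -/
structure AvoidsOn (m : ℕ) (f : ℕ → ℕ) : Prop where
  le : ∀ i ≤ m, f i ≤ m
  inj : ∀ i ≤ m, ∀ j ≤ m, f i = f j → i = j
  surj : ∀ v ≤ m, ∃ i ≤ m, f i = v
  avoids : ∀ i j k, i < j → j < k → k ≤ m → f j < f i → ¬ f i < f k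

/-- The letters of `g` increase up to its maximum `g r = m`; those before it are fixed points of
`f`, and the others, read cyclically, form a cycle of `f`. -/
structure FundOn (m : ℕ) (f g : ℕ → ℕ) (r : ℕ) : Prop where
  r_le : r ≤ m
  incr : ∀ i j, i < j → j ≤ r → g i < g j
  apply_r : g r = m
  fixed : ∀ i < r, f (g i) = g i
  cycle : ∀ i, r ≤ i → i < m → f (g i) = g (i + 1)
  last : f (g m) = m

namespace FundOn

variable {m r s : ℕ} {f g h : ℕ → ℕ}

theorem apply_zero_ne_zero (H : FundOn m f g r) (hf0 : f 0 ≠ 0) (hm : 0 < m) :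
    g 0 ≠ 0 := by
  intro h0
  rcases Nat.eq_zero_or_pos r with rfl | hr
  · have := H.apply_r; omega
  · have := H.fixed 0 hr
    rw [h0] at this
    exact hf0 this

theorem r_lt (H : FundOn m f g r) (hg : AvoidsOn m g) (hg0 : g 0 ≠ 0) : r < m := by
  refine lt_of_le_of_ne H.r_le ?_
  rintro rfl
  obtain ⟨i, hi, h0⟩ := hg.surj 0 (by omega)
  rcases Nat.eq_zero_or_pos i with rfl | hi'
  · exact hg0 h0
  · have := H.incr 0 i hi' hi
    omega

/-- Values below the last letter occur in increasing order. -/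
theorem incr_of_lt_last (hg : AvoidsOn m g) {i j : ℕ} (hij : i < j) (hj : j ≤ m)
    (hi : g i < g m) : g i < g j := by
  rcases hj.lt_or_eq with hj | rfl
  · have h1 := hg.avoids i j m hij hj le_rfl
    have h2 := hg.inj i (by omega) j (by omega)
    by_contra h3
    exact h1 (by omega) hi
  · exact hi

/-- The letters before the maximum increase. -/
theorem incr_of_le (hf : AvoidsOn m f) {p i j : ℕ} (hp : p ≤ m) (hfp : f p = m) (hij : i < j)
    (hj : j ≤ p) : f i < f j := by
  have h2 := hf.inj i (by omega) j (by omega)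
  have h4 := hf.inj i (by omega) p hp
  have h3 := hf.le i (by omega)
  rcases hj.lt_or_eq with hj | rfl
  · have h1 := hf.avoids i j p hij hj hp
    by_contra h3
    exact h1 (by omega) (by omega)
  · omega

theorem lt_apply (hf : AvoidsOn m f) (hf0 : f 0 ≠ 0) {p : ℕ} (hp : p ≤ m) (hfp : f p = m) :
    ∀ i ≤ p, i < f i := by
  intro i
  induction i with
  | zero => omega
  | succ i ih =>
    intro hi
    have := incr_of_le hf hp hfp (Nat.lt_add_one i) hi
    have := ih (by omega)
    omega

end FundOn

/-- A strictly increasing sequence on `[0, a]` with values in `[c, c + a]` is a translation. -/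
theorem eq_add_of_strictMono_of_le {q : ℕ → ℕ} {a c : ℕ} (hinc : ∀ i j, i < j → j ≤ a → q i < q j)
    (h0 : c ≤ q 0) (ha : q a ≤ c + a) : ∀ i ≤ a, q i = c + i := by
  have hlo : ∀ i ≤ a, c + i ≤ q i := by
    intro i
    induction i with
    | zero => intro _; omega
    | succ i ih =>
      intro hi
      have := hinc i (i + 1) (by omega) hi
      have := ih (by omega)
      omega
  have hhi : ∀ t ≤ a, q (a - t) ≤ c + (a - t) := by
    intro t
    induction t with
    | zero => intro _; simpa using ha
    | succ t ih =>
      intro ht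
      have := hinc (a - (t + 1)) (a - t) (by omega) (by omega)
      have := ih (by omega)
      omega
  intro i hi
  have := hlo i hi
  have h2 := hhi (a - i) (by omega)
  rw [show a - (a - i) = i by omega] at h2
  omega

/-- `g` is the word `k, …, m, k - 1, …, 0`. -/
def IsRiseFall (m k : ℕ) (g : ℕ → ℕ) : Prop :=
  (∀ i ≤ m - k, g i = k + i) ∧ ∀ i ≤ m, m - k < i → g i = m - i

/-- `g` is the word `m, 0, 1, …, m - 1`. -/
def IsBackShift (m : ℕ) (g : ℕ → ℕ) : Prop :=
  g 0 = m ∧ ∀ i < m, g (i + 1) = i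

namespace FundOn

variable {m r s : ℕ} {f g h : ℕ → ℕ}

/-- If the cycle part of `g` descends from `c - 1` to `0`, then `g` is `c, …, m, c - 1, …, 0`. -/
theorem isRiseFall (H : FundOn m f g r) {c : ℕ} (hc : 1 ≤ c)
    (hg : AvoidsOn m g) (hlow : ∀ i ≤ r, c ≤ g i) (hnext : g (r + 1) = c - 1)
    (hdesc : ∀ i, r < i → i < m → g i < c → 1 ≤ g i → g (i + 1) = g i - 1)
    (hlast : ∀ i, r < i → i < m → g i ≠ 0) :
    c ≤ m ∧ IsRiseFall m c g := by
  have hstep : ∀ t, t ≤ c - 1 → r + 1 + t ≤ m → g (r + 1 + t) = c - 1 - t := by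
    intro t
    induction t with
    | zero => intro _ _; simpa using hnext
    | succ t ih =>
      intro ht hle
      have h1 := ih (by omega) (by omega)
      have h2 := hdesc (r + 1 + t) (by omega) (by omega) (by omega) (by omega)
      rw [show r + 1 + (t + 1) = r + 1 + t + 1 by omega, h2, h1]
      omega
  have hrc : r + c ≤ m := by
    by_contra hcon
    have h0 : ∃ i ≤ m, g i = 0 := hg.surj 0 (by omega)
    obtain ⟨i, hi, hi0⟩ := h0
    rcases le_or_gt i r with hir | hir
    · have := hlow i hir; omega
    · have h1 := hstep (i - (r + 1)) (by omega) (by omega)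
      rw [show r + 1 + (i - (r + 1)) = i by omega] at h1
      omega
  have hrc' : r + c = m := by
    by_contra hcon
    have h1 := hstep (c - 1) le_rfl (by omega)
    exact hlast (r + 1 + (c - 1)) (by omega) (by omega) (by omega)
  have hup := eq_add_of_strictMono_of_le (q := g) (a := r) (c := c) H.incr (hlow 0 (by omega))
    (by rw [H.apply_r]; omega)
  refine ⟨by omega, fun i hi => hup i (by omega), fun i hi hi' => ?_⟩
  have h1 := hstep (i - (r + 1)) (by omega) (by omega)
  rw [show r + 1 + (i - (r + 1)) = i by omega] at h1
  omega

/-- The case where `f` has no fixed point. -/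
theorem isRiseFall_of_r_eq_zero (H : FundOn m f g 0) (H' : FundOn m g h s)
    (hf : AvoidsOn m f) (hg : AvoidsOn m g) (hh : AvoidsOn m h) (hf0 : f 0 ≠ 0) (hm : 0 < m) :
    ∃ k, 1 ≤ k ∧ k ≤ m ∧ IsRiseFall m k h := by
  have hg0 := H.apply_r
  set p := g m with hp
  have hfp : f p = m := H.last
  have hpm : p < m := by
    have h1 := hg.le m le_rfl
    have h2 := hg.inj 0 (by omega) m le_rfl
    omega
  have hhm : h m = 0 := by
    apply hg.inj _ (hh.le m le_rfl) _ (by omega)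
    rw [H'.last, hg0]
  have hsm : s < m := by
    refine lt_of_le_of_ne H'.r_le ?_
    rintro rfl
    have := H'.apply_r
    omega
  have hs1 : h (s + 1) = p := by
    rw [← H'.cycle s le_rfl hsm, H'.apply_r]
  have hpos : ∀ w, w < p → ∀ j ≤ m, g j = w → w + 1 ≤ j := by
    intro w
    induction w with
    | zero =>
      intro _ j _ hj
      by_contra hcon
      rw [show j = 0 by omega] at hj
      omega
    | succ w ih =>
      intro hw j hj hjw
      obtain ⟨i, hi, hiw⟩ := hg.surj w (by omega)
      have h1 := ih (by omega) i hi hiw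
      have h2 : i < j := by
        by_contra hcon
        have h3 : j ≠ i := by rintro rfl; omega
        have h4 := incr_of_lt_last hg (show j < i by omega) hi (by omega)
        omega
      omega
  have hfix : ∀ v ≤ m, g v = v → p < v := by
    intro v hv hgv
    by_contra hcon
    rcases (not_lt.1 hcon).lt_or_eq with h1 | h1
    · have := hpos v h1 v hv hgv; omega
    · have h2 := hg.inj v hv m le_rfl
      omega
  have hlow : ∀ i ≤ s, p < h i := by
    intro i hi
    rcases hi.lt_or_eq with hi | rfl
    · exact hfix _ (hh.le i (by omega)) (H'.fixed i hi)
    · rw [H'.apply_r]; exact hpm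
  have hmap : ∀ v, 1 ≤ v → v < p → g v < p := by
    intro v hv hvp
    obtain ⟨i, hi, hiv⟩ := hh.surj v (by omega)
    have hi1 : s + 1 < i := by
      by_contra hcon
      rcases (not_lt.1 hcon).lt_or_eq with h1 | h1
      · have := hlow i (by omega); omega
      · rw [h1] at hiv; omega
    have him : i < m := by
      refine lt_of_le_of_ne hi ?_
      rintro rfl
      omega
    have h1 := H'.cycle i (by omega) him
    rw [hiv] at h1
    have h2 := hh.avoids (s + 1) i (i + 1) hi1 (by omega) him (by omega)
    have h3 := hh.inj (s + 1) (by omega) (i + 1) him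
    rw [h1]
    omega
  have hlo : ∀ v, v + 1 < p → v ≤ g (v + 1) := by
    intro v
    induction v with
    | zero => omega
    | succ v ih =>
      intro hv
      have h1 := ih (by omega)
      have h2 := hmap (v + 1) (by omega) (by omega)
      have h3 := incr_of_lt_last hg (show v + 1 < v + 1 + 1 by omega) (by omega) h2
      omega
  have hgv : ∀ v, v + 1 < p → g (v + 1) = v := by
    intro v hv
    have h1 := hlo v hv
    have h2 := hmap (v + 1) (by omega) (by omega)
    have h3 := hpos _ h2 (v + 1) (by omega) rfl
    omega
  have hgp : 1 ≤ p → g p = p - 1 := by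
    intro hp1
    obtain ⟨x, hx, hgx⟩ := hg.surj (p - 1) (by omega)
    have hpx : p ≤ x := by
      have := hpos (p - 1) (by omega) x hx hgx; omega
    rcases hpx.lt_or_eq with hpx | rfl
    · exfalso
      have hxm : x < m := by
        refine lt_of_le_of_ne hx ?_
        rintro rfl
        omega
      have hu : p < g p := by
        by_contra hcon
        have h1 : g p ≠ p := fun h => by
          have := hg.inj p hpm.le m le_rfl (by omega); omega
        have h2 : g p ≠ p - 1 := fun h => by
          have := hg.inj p hpm.le x hx (by omega); omega
        have h3 := hg.inj p hpm.le (g p + 1) (by omega) (hgv (g p) (by omega)).symm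
        omega
      have hz : g (x + 1) < g p := by
        have h1 := hg.avoids p x (x + 1) hpx (by omega) hxm (by omega)
        have h2 := hg.inj p hpm.le (x + 1) hxm
        omega
      have hfx := H.cycle x (by omega) hxm
      rw [hgx] at hfx
      rcases Nat.lt_or_ge 1 p with hp2 | hp2
      · have h1 := H.cycle (p - 1) (by omega) (by omega)
        have h2 := hgv (p - 2) (by omega)
        rw [show p - 2 + 1 = p - 1 by omega] at h2
        rw [h2, show p - 1 + 1 = p by omega] at h1
        have h3 := incr_of_le hf hpm.le hfp (show p - 2 < p - 1 by omega) (by omega)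
        omega
      · have hp1' : p = 1 := by omega
        have h1 := H.cycle 0 le_rfl hm
        rw [hg0, zero_add, ← hp1'] at h1
        obtain ⟨j, hj, hj0⟩ := hf.surj 0 (by omega)
        rw [show p - 1 = 0 by omega] at hfx
        have h2 : j ≠ 0 := by rintro rfl; exact hf0 hj0
        have h3 : j ≠ m := by rintro rfl; omega
        exact hf.avoids 0 j m (by omega) (by omega) le_rfl (by omega) (by omega)
    · exact hgx
  have hgall : ∀ v, 1 ≤ v → v ≤ p → g v = v - 1 := by
    intro v hv hvp
    rcases hvp.lt_or_eq with hvp | rfl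
    · have := hgv (v - 1) (by omega)
      rwa [show v - 1 + 1 = v by omega] at this
    · exact hgp hv
  obtain ⟨h1, h2⟩ := H'.isRiseFall (c := p + 1) (by omega) hh (fun i hi => hlow i hi)
    (by simpa using hs1)
    (fun i hi him hip hi1 => by rw [← H'.cycle i hi.le him, hgall _ hi1 (by omega)])
    (fun i hi him hi0 => by have := hh.inj i him.le m le_rfl (by omega); omega)
  exact ⟨p + 1, by omega, h1, h2⟩

/-- If `f` has a fixed point, then `g` is either `c, …, m, c - 1, …, 0` or
`c, …, m, 0, 1, …, c - 1`. -/
theorem isRiseFall_or_rotation (H : FundOn m f g r) (hf : AvoidsOn m f) (hg : AvoidsOn m g)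
    (hf0 : f 0 ≠ 0) (hr : 0 < r) (hrm : r < m) :
    (∃ c, 1 ≤ c ∧ c ≤ m ∧ IsRiseFall m c g) ∨
      (1 ≤ g m ∧ r + 1 + g m = m ∧ (∀ i ≤ r, g i = g m + 1 + i) ∧
        ∀ i, r < i → i ≤ m → g i = i - (r + 1)) := by
  set p := g m with hp
  have hfp : f p = m := H.last
  have hpm : p ≤ m := hg.le m le_rfl
  have hp1 : p ≠ m := by
    intro h
    have := hg.inj r hrm.le m le_rfl (by rw [H.apply_r]; omega)
    omega
  have hgr := H.apply_r
  have hfm := H.cycle r le_rfl hrm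
  rw [hgr] at hfm
  set c := g 0 with hc
  have hcm : c < m := by
    have := H.incr 0 r hr le_rfl
    omega
  have hfc : f c = c := H.fixed 0 hr
  have hpc : p < c := by
    by_contra hcon
    have := lt_apply hf hf0 hpm hfp c (by omega)
    omega
  have hfix : ∀ v < c, f v ≠ v := by
    intro v hv hfv
    obtain ⟨i, hi, rfl⟩ := hg.surj v (by omega)
    rcases Nat.lt_or_ge i r with hir | hir
    · rcases Nat.eq_zero_or_pos i with rfl | h0
      · omega
      · have := H.incr 0 i h0 hir.le
        omega
    · have him : i < m := by
        refine lt_of_le_of_ne hi ?_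
        rintro rfl
        have := H.last
        omega
      rw [H.cycle i hir him] at hfv
      have := hg.inj _ him _ hi hfv
      omega
  have hmap : ∀ v < c, v ≠ p → f v < c := by
    intro v hv hvp
    obtain ⟨i, hi, rfl⟩ := hg.surj v (by omega)
    have hir : r < i := by
      by_contra hcon
      rcases Nat.eq_zero_or_pos i with rfl | h0
      · omega
      · have := H.incr 0 i h0 (by omega)
        omega
    have him : i < m := by
      refine lt_of_le_of_ne hi ?_
      rintro rfl
      exact hvp rfl
    rw [H.cycle i hir.le him]
    have h1 := hg.avoids 0 i (i + 1) (by omega) (by omega) him (by omega)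
    have h2 := hg.inj 0 (by omega) (i + 1) him
    omega
  have hincr : ∀ i j, i < j → j < c → i ≠ p → j ≠ p → f i < f j := by
    intro i j hij hj hip hjp
    have h1 := hf.avoids i j c hij hj hcm.le
    have h2 := hf.inj i (by omega) j (by omega)
    have h3 := hmap i (by omega) hip
    omega
  have hdown : ∀ t, p < c - 1 - t → t < c → f (c - 1 - t) ≤ c - 1 - t := by
    intro t
    induction t with
    | zero =>
      intro h1 h2
      have := hmap (c - 1) (by omega) (by omega)
      simp only [Nat.sub_zero]
      omega
    | succ t ih =>
      intro h1 h2
      have h3 := hincr (c - 1 - (t + 1)) (c - 1 - t) (by omega) (by omega) (by omega) (by omega)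
      have h4 := ih (by omega) (by omega)
      omega
  have hle : ∀ j, p < j → j < c → f j ≤ j := by
    intro j h1 h2
    have := hdown (c - 1 - j) (by omega) (by omega)
    rwa [show c - 1 - (c - 1 - j) = j by omega] at this
  have hlast : ∀ w < c, (∀ j < c, f j ≠ w) → (∀ v < c, v ≠ w → ∃ j < c, f j = v) → f m = w := by
    intro w hw hj hv
    obtain ⟨j, hjm, hjw⟩ := hf.surj w (by omega)
    have hcj : c < j := by
      by_contra hcon
      rcases (not_lt.1 hcon).lt_or_eq with h1 | rfl
      · exact hj j h1 hjw
      · omega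
    by_contra hne
    have hjm' : j < m := by
      refine lt_of_le_of_ne hjm ?_
      rintro rfl
      exact hne hjw
    have h1 := hf.avoids c j m hcj hjm' le_rfl (by omega)
    have h2 := hf.inj c hcm.le m le_rfl
    obtain ⟨i, hi, hfi⟩ := hv (f m) (by omega) hne
    have := hf.inj i (by omega) m le_rfl hfi
    omega
  rcases Nat.eq_zero_or_pos p with hp0 | hp0
  · left
    have hlo : ∀ j, j + 1 < c → j ≤ f (j + 1) := by
      intro j
      induction j with
      | zero => omega
      | succ j ih =>
        intro hj
        have h1 := ih (by omega)
        have h2 := hincr (j + 1) (j + 1 + 1) (by omega) hj (by omega) (by omega)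
        omega
    have hfv : ∀ v, 1 ≤ v → v < c → f v = v - 1 := by
      intro v h1 h2
      have h3 := hlo (v - 1) (by omega)
      rw [show v - 1 + 1 = v by omega] at h3
      have h4 := hle v (by omega) h2
      have h5 := hfix v h2
      omega
    have hfm' : f m = c - 1 := by
      refine hlast (c - 1) (by omega) (fun j hj h => ?_) fun v hv hne => ⟨v + 1, by omega, ?_⟩
      · rcases Nat.eq_zero_or_pos j with rfl | h0
        · rw [← hp0, hfp] at h
          omega
        · have := hfv j h0 hj
          omega
      · exact hfv (v + 1) (by omega) (by omega)
    obtain ⟨h1, h2⟩ := H.isRiseFall (c := c) (by omega) hg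
      (fun i hi => by
        rcases Nat.eq_zero_or_pos i with rfl | h0
        · exact le_rfl
        · exact (H.incr 0 i h0 hi).le)
      (by omega)
      (fun i hi him hic hi1 => by rw [← H.cycle i hi.le him, hfv _ hi1 hic])
      (fun i hi him hi0 => by have := hg.inj i him.le m le_rfl (by omega); omega)
    exact ⟨c, by omega, h1, h2⟩
  · right
    have hlo : ∀ j, p + j < c → p + j ≤ f (p + j) := by
      intro j
      induction j with
      | zero => rw [add_zero]; omega
      | succ j ih =>
        intro hj
        rcases Nat.eq_zero_or_pos j with rfl | h0
        · have h1 := lt_apply hf hf0 hpm hfp (p - 1) (by omega)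
          have h2 := hincr (p - 1) (p + (0 + 1)) (by omega) hj (by omega) (by omega)
          omega
        · have h1 := ih (by omega)
          have h2 := hincr (p + j) (p + (j + 1)) (by omega) hj (by omega) (by omega)
          omega
    have hcp : c = p + 1 := by
      by_contra hcon
      have h1 := hle (p + 1) (by omega) (by omega)
      have h2 := hlo 1 (by omega)
      exact hfix (p + 1) (by omega) (by omega)
    have hfv : ∀ t ≤ p, 1 ≤ t → f (p - t) = p - t + 1 := by
      intro t
      induction t with
      | zero => omega
      | succ t ih =>
        intro ht _
        have h3 := lt_apply hf hf0 hpm hfp (p - (t + 1)) (by omega)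
        rcases Nat.eq_zero_or_pos t with rfl | h0
        · have := hmap (p - (0 + 1)) (by omega) (by omega)
          omega
        · have h1 := ih (by omega) h0
          have h2 := hincr (p - (t + 1)) (p - t) (by omega) (by omega) (by omega) (by omega)
          omega
    have hfm' : f m = 0 := by
      refine hlast 0 (by omega) (fun j hj h => ?_) fun v hv hne => ⟨v - 1, by omega, ?_⟩
      · rcases Nat.lt_or_ge j p with h0 | h0
        · have := hfv (p - j) (by omega) (by omega)
          rw [show p - (p - j) = j by omega] at this
          omega
        · rw [show j = p by omega] at h
          omega
      · have := hfv (p - (v - 1)) (by omega) (by omega)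
        rw [show p - (p - (v - 1)) = v - 1 by omega] at this
        omega
    have hstep : ∀ t, t ≤ p → r + 1 + t ≤ m → g (r + 1 + t) = t := by
      intro t
      induction t with
      | zero => intro _ _; rw [add_zero]; omega
      | succ t ih =>
        intro ht hle
        have h1 := H.cycle (r + 1 + t) (by omega) (by omega)
        have h2 := hfv (p - t) (by omega) (by omega)
        rw [show p - (p - t) = t by omega] at h2
        rw [ih (by omega) (by omega), h2] at h1
        exact h1.symm
    have hge : m ≤ r + 1 + p := by
      by_contra hcon
      have h1 := hstep p le_rfl (by omega)
      have := hg.inj _ (by omega) _ le_rfl (h1.trans hp)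
      omega
    have hle' : r + 1 + p ≤ m := by
      have h1 := hstep (m - (r + 1)) (by omega) (by omega)
      rw [show r + 1 + (m - (r + 1)) = m by omega] at h1
      omega
    have hup := eq_add_of_strictMono_of_le (q := g) (a := r) (c := p + 1) H.incr (by omega)
      (by omega)
    refine ⟨hp0, by omega, hup, fun i hi him => ?_⟩
    have h1 := hstep (i - (r + 1)) (by omega) (by omega)
    rwa [show r + 1 + (i - (r + 1)) = i by omega] at h1

/-- The word `c, …, m, 0, …, c - 1` with `c ≥ 2` is not followed by a `213`-avoiding word. -/
theorem not_rotation (H' : FundOn m g h s) (hg : AvoidsOn m g) (hh : AvoidsOn m h) (hr : 0 < r)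
    (hp : 1 ≤ g m) (hrm : r + 1 + g m = m) (hlow : ∀ i ≤ r, g i = g m + 1 + i)
    (hhigh : ∀ i, r < i → i ≤ m → g i = i - (r + 1)) : False := by
  have hs : s = 0 := by
    by_contra hs
    have h1 := H'.fixed 0 (by omega)
    have h2 := hh.le 0 (by omega)
    rcases le_or_gt (h 0) r with h3 | h3
    · have := hlow _ h3; omega
    · have := hhigh _ h3 h2; omega
  subst hs
  have h0 := H'.apply_r
  have h1 := H'.cycle 0 le_rfl (by omega)
  have h2 := H'.cycle 1 (by omega) (by omega)
  simp only [h0, zero_add, Nat.reduceAdd] at h1 h2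
  rw [← h1] at h2
  have hhm : h m = r := by
    apply hg.inj _ (hh.le m le_rfl) _ (by omega)
    rw [H'.last, hlow r le_rfl]
    omega
  have h5 := hh.inj 1 (by omega) m le_rfl
  obtain ⟨j, hj, hj0⟩ := hh.surj 0 (by omega)
  have hj1 : 1 < j := by
    by_contra hcon
    obtain rfl | rfl : j = 0 ∨ j = 1 := by omega
    all_goals omega
  have h4 : r < g m := by
    by_contra hcon
    have := incr_of_lt_last hh hj1 hj (by omega)
    omega
  have h6 := hhigh (g m) h4 (by omega)
  obtain ⟨i, hi, hi1⟩ := hh.surj (m - 1) (by omega)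
  have hi2 : 2 < i := by
    by_contra hcon
    obtain rfl | rfl | rfl : i = 0 ∨ i = 1 ∨ i = 2 := by omega
    all_goals omega
  exact hh.avoids 1 2 i (by omega) hi2 hi (by omega) (by omega)

/-- The word `k, …, m, k - 1, …, 0` with `k ≥ 2` is not followed by a `213`-avoiding word. -/
theorem not_isRiseFall {k : ℕ} (H : FundOn m f h s) (hm : 4 ≤ m) (hk : 2 ≤ k) (hkm : k ≤ m)
    (hW : IsRiseFall m k f) (hf : AvoidsOn m f) (hh : AvoidsOn m h) : False := by
  obtain ⟨hlow, hhigh⟩ := hW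
  have hhm : h m = m - k := by
    apply hf.inj _ (hh.le m le_rfl) _ (by omega)
    rw [H.last, hlow _ le_rfl]
    omega
  have hf0 := hlow 0 (by omega)
  have hsm := H.r_lt hh (H.apply_zero_ne_zero (by omega) (by omega))
  have hfix : ∀ v ≤ m, f v = v → m - k < v ∧ v + v = m := by
    intro v hv hfv
    rcases le_or_gt v (m - k) with h1 | h1
    · have := hlow v h1; omega
    · have := hhigh v hv h1; omega
  have hs1 : s ≤ 1 := by
    by_contra hcon
    have h1 := hfix _ (hh.le 0 (by omega)) (H.fixed 0 (by omega))
    have h2 := hfix _ (hh.le 1 (by omega)) (H.fixed 1 (by omega))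
    have := hh.inj 0 (by omega) 1 (by omega)
    omega
  have h1 := H.cycle s le_rfl hsm
  rw [H.apply_r, hhigh m le_rfl (by omega), Nat.sub_self] at h1
  have h2 := H.cycle (s + 1) (by omega) (by omega)
  rw [← h1, hf0] at h2
  obtain rfl | rfl : s = 0 ∨ s = 1 := by omega
  · simp only [zero_add, Nat.reduceAdd, add_zero] at h1 h2
    have h3 := H.cycle 2 (by omega) (by omega)
    rw [← h2] at h3
    simp only [Nat.reduceAdd] at h3
    rcases lt_trichotomy k (m - k) with h4 | h4 | h4
    · obtain ⟨j, hj, hj1⟩ := hh.surj 1 (by omega)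
      have hj2 : 2 < j := by
        by_contra hcon
        have h0 := H.apply_r
        obtain rfl | rfl | rfl : j = 0 ∨ j = 1 ∨ j = 2 := by omega
        all_goals omega
      have := incr_of_lt_last hh hj2 hj (by omega)
      omega
    · have := hh.inj 2 (by omega) m le_rfl
      omega
    · rw [hhigh k hkm h4] at h3
      have := hh.inj 3 (by omega) m le_rfl
      omega
  · have h3 := hfix _ (hh.le 0 (by omega)) (H.fixed 0 (by omega))
    simp only [Nat.reduceAdd, add_zero] at h1 h2
    exact hh.avoids 0 2 3 (by omega) (by omega) (by omega) (by omega) (by omega)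

theorem isBackShift (H : FundOn m f h s) (hm : 2 ≤ m) (hW : IsRiseFall m 1 f)
    (hh : AvoidsOn m h) : IsBackShift m h := by
  obtain ⟨hlow, hhigh⟩ := hW
  have hfm := hhigh m le_rfl (by omega)
  have hs : s = 0 := by
    by_contra hs
    have h1 := H.fixed 0 (by omega)
    have h2 := hh.le 0 (by omega)
    rcases le_or_gt (h 0) (m - 1) with h3 | h3
    · have := hlow _ h3; omega
    · have := hhigh _ h2 h3; omega
  subst hs
  refine ⟨H.apply_r, fun i hi => ?_⟩
  induction i with
  | zero => rw [← H.cycle 0 le_rfl hi, H.apply_r]; omega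
  | succ i ih =>
    rw [← H.cycle (i + 1) (by omega) hi, ih (by omega), hlow i (by omega)]
    omega

/-- The third word of a chain of nontrivial `213`-avoiding words. -/
theorem isBackShift_or_isRiseFall (H : FundOn m f g r) (H' : FundOn m g h s)
    (hf : AvoidsOn m f) (hg : AvoidsOn m g) (hh : AvoidsOn m h) (hf0 : f 0 ≠ 0) (hm : 4 ≤ m) :
    IsBackShift m h ∨ ∃ k, 1 ≤ k ∧ k ≤ m ∧ IsRiseFall m k h := by
  rcases Nat.eq_zero_or_pos r with rfl | hr
  · exact Or.inr (H.isRiseFall_of_r_eq_zero H' hf hg hh hf0 (by omega))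
  have hg0 := H.apply_zero_ne_zero hf0 (by omega)
  rcases H.isRiseFall_or_rotation hf hg hf0 hr (H.r_lt hg hg0) with
    ⟨c, hc, hcm, hW⟩ | ⟨hp, hrm, hlow, hhigh⟩
  · obtain rfl | hc : c = 1 ∨ 2 ≤ c := by omega
    · exact Or.inl (H'.isBackShift (by omega) hW hh)
    · exact (H'.not_isRiseFall hm hc hcm hW hg hh).elim
  · exact (H'.not_rotation hg hh hr hp hrm hlow hhigh).elim

end FundOn

section Represents

variable {m : ℕ} {π σ : Equiv.Perm (Fin (m + 1))} {f g : ℕ → ℕ}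

/-- `f` agrees with `π` on `{0, …, m}`. -/
def Represents (f : ℕ → ℕ) (π : Equiv.Perm (Fin (m + 1))) : Prop :=
  ∀ i (hi : i < m + 1), (π ⟨i, hi⟩ : ℕ) = f i

theorem Represents.apply (h : Represents f π) (i : Fin (m + 1)) : (π i : ℕ) = f i := h i i.2

theorem exists_represents (π : Equiv.Perm (Fin (m + 1))) : ∃ f, Represents f π :=
  ⟨fun i => if hi : i < m + 1 then π ⟨i, hi⟩ else 0, fun i hi => by simp [hi]⟩

theorem Represents.eq (hf : Represents f π) (hg : Represents g σ) (h : ∀ i ≤ m, f i = g i) :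
    π = σ := by
  ext i
  rw [hf.apply, hg.apply, h i (by omega)]

theorem Represents.avoidsOn (hf : Represents f π) (h : Avoids213 π) : AvoidsOn m f where
  le i hi := by
    rw [← hf i (by omega)]
    omega
  inj i hi j hj hij := by
    rw [← hf i (by omega), ← hf j (by omega)] at hij
    exact congrArg Fin.val (π.injective (Fin.ext hij))
  surj v hv := by
    obtain ⟨i, hi⟩ := π.surjective ⟨v, by omega⟩
    exact ⟨i, by omega, by rw [← hf.apply, hi]⟩
  avoids i j k hij hjk hk := by
    rw [← hf i (by omega), ← hf j (by omega), ← hf k (by omega)]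
    exact h _ _ _ hij hjk

theorem Represents.avoids213 (hf : Represents f π) (h : AvoidsOn m f) : Avoids213 π := by
  intro i j k hij hjk
  rw [Fin.lt_def, Fin.lt_def, hf.apply, hf.apply, hf.apply]
  exact h.avoids i j k hij hjk (by omega)

theorem Represents.fundOn (hf : Represents f π) (hg : Represents g σ) (h : IsTheta π σ)
    (hσ : Avoids213 σ) : ∃ r, FundOn m f g r := by
  have hga := hg.avoidsOn hσ
  obtain ⟨r, hr, hgr⟩ := hga.surj m le_rfl
  have hincr : ∀ i j, i < j → j ≤ r → g i < g j := fun i j hij hj =>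
    FundOn.incr_of_le hga hr hgr hij hj
  have hle : ∀ i ≤ m, g i ≤ m := hga.le
  refine ⟨r, hr, hincr, hgr, fun i hi => ?_, fun i hi him => ?_, ?_⟩
  · rcases h ⟨i, by omega⟩ with ⟨j, hj, ⟨l, hl, hlt⟩, -⟩ | ⟨-, l, hl, he, hmax⟩
    · rw [Fin.lt_def, hg.apply, hg.apply] at hlt
      rw [Fin.le_def] at hl
      have := hincr l j (by simp at hj hl; omega) (by simp at hj; omega)
      omega
    · have h1 := hmax ⟨i, by omega⟩ le_rfl
      rw [Fin.le_def] at h1 hl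
      have h2 : l.val = i := by
        by_contra hne
        have := hincr l i (by simp at hl; omega) hi.le
        rw [hg.apply, hg.apply] at h1
        simp at h1
        omega
      have h3 := congrArg Fin.val he
      rwa [hf.apply, hg.apply, hg.apply, h2] at h3
  · have h0 : ∃ l : Fin (m + 1), l.val ≤ i ∧ σ ⟨i + 1, by omega⟩ < σ l := by
      refine ⟨⟨r, by omega⟩, hi, ?_⟩
      rw [Fin.lt_def, hg, hg, hgr]
      have h1 := hle (i + 1) him
      have h2 := hga.inj (i + 1) him r hr
      omega
    rcases h ⟨i, by omega⟩ with ⟨j, hj, -, he⟩ | ⟨hj, -⟩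
    · have h3 := congrArg Fin.val he
      rwa [hf.apply, hg.apply, hg.apply, hj] at h3
    · obtain ⟨l, hl, hlt⟩ := h0
      exact absurd (hj ⟨i + 1, by omega⟩ rfl l hl) hlt.asymm
  · rcases h ⟨m, by omega⟩ with ⟨j, hj, -⟩ | ⟨-, l, hl, he, hmax⟩
    · simp at hj
      omega
    · have h1 := hmax ⟨r, by omega⟩ hr
      rw [Fin.le_def, hg, hg.apply, hgr] at h1
      have h3 := congrArg Fin.val he
      rw [hf.apply, hg.apply, hg.apply] at h3
      have := hle l (by omega)
      simp only at h3
      omega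

theorem FundOn.isTheta {r : ℕ} (H : FundOn m f g r) (hf : Represents f π) (hg : Represents g σ) :
    IsTheta π σ := by
  have hr := H.r_le
  have hle : ∀ l : Fin (m + 1), g l ≤ m := fun l => by
    rw [← hg.apply]
    omega
  intro i
  simp only [Fin.lt_def, Fin.le_def, Fin.ext_iff, hf.apply, hg.apply]
  rcases Nat.lt_or_ge i r with hi | hi
  · right
    refine ⟨fun j hj l hl => H.incr l j (by omega) (by omega), i, le_rfl, H.fixed i hi,
      fun l hl => ?_⟩
    rcases hl.lt_or_eq with hl | hl
    · exact (H.incr l i hl hi.le).le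
    · rw [hl]
  · rcases (show i.val ≤ m by omega).lt_or_eq with him | him
    · left
      refine ⟨⟨i + 1, by omega⟩, rfl, ⟨⟨r, by omega⟩, hi, ?_⟩, H.cycle i hi him⟩
      have h1 := hle ⟨i + 1, by omega⟩
      have h2 : g (i + 1) ≠ g r := by
        intro h
        rw [← hg (i + 1) (by omega), ← hg r (by omega)] at h
        have := congrArg Fin.val (σ.injective (Fin.ext h))
        simp at this
        omega
      have h3 := H.apply_r
      simp only at h1 ⊢
      omega
    · right
      refine ⟨fun j hj => by omega, ⟨r, by omega⟩, hi, ?_, fun l _ => ?_⟩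
      · rw [him, H.last, H.apply_r]
      · simp only [H.apply_r]
        exact hle l

theorem FundOn.theta_eq {r : ℕ} (H : FundOn m f g r) (hf : Represents f π)
    (hg : Represents g σ) : theta π = σ :=
  theta_eq_iff.2 (H.isTheta hf hg)

/-- The permutation represented by `f`, if any. -/
noncomputable def permOfFun (m : ℕ) (f : ℕ → ℕ) : Equiv.Perm (Fin (m + 1)) :=
  Classical.epsilon fun π => Represents f π

theorem AvoidsOn.represents (h : AvoidsOn m f) : Represents f (permOfFun m f) := by
  apply Classical.epsilon_spec (p := fun π : Equiv.Perm (Fin (m + 1)) => Represents f π)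
  have hinj : Function.Injective fun i : Fin (m + 1) =>
      (⟨f i, Nat.lt_succ_of_le (h.le i (by omega))⟩ : Fin (m + 1)) := fun i j hij =>
    Fin.ext (h.inj i (by omega) j (by omega) (by simpa using hij))
  exact ⟨Equiv.ofBijective _ (Finite.injective_iff_bijective.1 hinj), fun i hi => rfl⟩

end Represents

/-- The word `m, 1, 2, …, m - 1, 0`. -/
def swapWord (m i : ℕ) : ℕ := if i = 0 then m else if i = m then 0 else i

/-- The word `m, 2, 3, …, m - 1, 0, 1`. -/
def doubleShiftWord (m i : ℕ) : ℕ :=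
  if i = 0 then m else if i = m then 1 else if i + 1 = m then 0 else i + 1

/-- The word `m, 0, 1, …, m - 1`. -/
def backShiftWord (m i : ℕ) : ℕ := if i = 0 then m else i - 1

/-- The word `1, 2, …, m, 0`. -/
def shiftWord (m i : ℕ) : ℕ := if i = m then 0 else i + 1

section Words

variable {m : ℕ}

theorem avoidsOn_swapWord (hm : 1 ≤ m) : AvoidsOn m (swapWord m) where
  le i hi := by unfold swapWord; grind
  inj i hi j hj := by unfold swapWord; grind
  surj v hv := ⟨swapWord m v, by unfold swapWord; grind, by unfold swapWord; grind⟩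
  avoids i j k hij hjk hk := by unfold swapWord; grind

theorem avoidsOn_doubleShiftWord (hm : 2 ≤ m) : AvoidsOn m (doubleShiftWord m) where
  le i hi := by unfold doubleShiftWord; grind
  inj i hi j hj := by unfold doubleShiftWord; grind
  surj v hv := ⟨if v = m then 0 else if v = 1 then m else if v = 0 then m - 1 else v - 1,
    by grind, by unfold doubleShiftWord; grind⟩
  avoids i j k hij hjk hk := by unfold doubleShiftWord; grind

theorem avoidsOn_backShiftWord : AvoidsOn m (backShiftWord m) where
  le i hi := by unfold backShiftWord; grind
  inj i hi j hj := by unfold backShiftWord; grind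
  surj v hv := ⟨if v = m then 0 else v + 1, by grind, by unfold backShiftWord; grind⟩
  avoids i j k hij hjk hk := by unfold backShiftWord; grind

theorem avoidsOn_shiftWord : AvoidsOn m (shiftWord m) where
  le i hi := by unfold shiftWord; grind
  inj i hi j hj := by unfold shiftWord; grind
  surj v hv := ⟨if v = 0 then m else v - 1, by grind, by unfold shiftWord; grind⟩
  avoids i j k hij hjk hk := by unfold shiftWord; grind

theorem avoidsOn_rev : AvoidsOn m (m - ·) where
  le i hi := by omega
  inj i hi j hj := by omega
  surj v hv := ⟨m - v, by omega, by omega⟩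
  avoids i j k hij hjk hk := by omega

theorem theta_doubleShift (hm : 2 ≤ m) :
    theta (permOfFun m (doubleShiftWord m)) = permOfFun m (swapWord m) := by
  refine FundOn.theta_eq (r := 0) ⟨?_, ?_, ?_, ?_, ?_, ?_⟩ (avoidsOn_doubleShiftWord hm).represents
    (avoidsOn_swapWord (by omega)).represents
  all_goals grind [doubleShiftWord, swapWord]

theorem theta_swap (hm : 2 ≤ m) :
    theta (permOfFun m (swapWord m)) = permOfFun m (shiftWord m) := by
  refine FundOn.theta_eq (r := m - 1) ⟨?_, ?_, ?_, ?_, ?_, ?_⟩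
    (avoidsOn_swapWord (by omega)).represents avoidsOn_shiftWord.represents
  all_goals grind [swapWord, shiftWord]

theorem theta_shift (hm : 2 ≤ m) :
    theta (permOfFun m (shiftWord m)) = permOfFun m (backShiftWord m) := by
  refine FundOn.theta_eq (r := 0) ⟨?_, ?_, ?_, ?_, ?_, ?_⟩
    avoidsOn_shiftWord.represents avoidsOn_backShiftWord.represents
  all_goals grind [shiftWord, backShiftWord]

theorem theta_backShift :
    theta (permOfFun m (backShiftWord m)) = permOfFun m (m - ·) := by
  refine FundOn.theta_eq (r := 0) ⟨?_, ?_, ?_, ?_, ?_, ?_⟩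
    avoidsOn_backShiftWord.represents avoidsOn_rev.represents
  all_goals grind [backShiftWord]

end Words

section Irreducible

variable {m : ℕ}

theorem swap_mem (hm : 2 ≤ m) : permOfFun m (swapWord m) ∈ thetaAvoiders (m + 1) 3 := by
  simp only [mem_thetaAvoiders_succ, mem_thetaAvoiders_zero, theta_swap hm, theta_shift hm,
    theta_backShift]
  have hA := avoidsOn_swapWord (m := m) (by omega)
  exact ⟨hA.represents.avoids213 hA,
    avoidsOn_shiftWord.represents.avoids213 avoidsOn_shiftWord,
    avoidsOn_backShiftWord.represents.avoids213 avoidsOn_backShiftWord,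
    avoidsOn_rev.represents.avoids213 avoidsOn_rev⟩

theorem doubleShift_mem (hm : 2 ≤ m) :
    permOfFun m (doubleShiftWord m) ∈ thetaAvoiders (m + 1) 4 := by
  rw [mem_thetaAvoiders_succ, theta_doubleShift hm]
  have hB := avoidsOn_doubleShiftWord hm
  exact ⟨hB.represents.avoids213 hB, swap_mem hm⟩

theorem swap_notMem (hm : 4 ≤ m) : permOfFun m (swapWord m) ∉ thetaAvoiders (m + 1) 4 := by
  simp only [mem_thetaAvoiders_succ, mem_thetaAvoiders_zero, theta_swap (show 2 ≤ m by omega),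
    theta_shift (show 2 ≤ m by omega), theta_backShift]
  rintro ⟨-, -, -, -, h⟩
  obtain ⟨g, hg⟩ := exists_represents (theta (permOfFun m (m - ·)))
  obtain ⟨r, H⟩ := avoidsOn_rev.represents.fundOn hg (isTheta_theta _) h
  refine H.not_isRiseFall (k := m) hm (by omega) le_rfl ⟨fun i hi => ?_, fun i _ _ => rfl⟩
    avoidsOn_rev (hg.avoidsOn h)
  beta_reduce
  omega

theorem doubleShift_notMem (hm : 4 ≤ m) :
    permOfFun m (doubleShiftWord m) ∉ thetaAvoiders (m + 1) 5 := by
  rw [mem_thetaAvoiders_succ, theta_doubleShift (by omega)]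
  exact fun h => swap_notMem hm h.2

theorem eq_of_mem_of_apply_zero_ne_zero (hm : 4 ≤ m) {π : Equiv.Perm (Fin (m + 1))}
    (hπ : π ∈ thetaAvoiders (m + 1) 3) (h0 : π 0 ≠ 0) :
    π = permOfFun m (swapWord m) ∨ π = permOfFun m (doubleShiftWord m) := by
  simp only [mem_thetaAvoiders_succ, mem_thetaAvoiders_zero] at hπ
  obtain ⟨a0, a1, a2, a3⟩ := hπ
  obtain ⟨f0, r0⟩ := exists_represents π
  obtain ⟨f1, r1⟩ := exists_represents (theta π)
  obtain ⟨f2, r2⟩ := exists_represents (theta (theta π))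
  obtain ⟨f3, r3⟩ := exists_represents (theta (theta (theta π)))
  obtain ⟨s1, H1⟩ := r0.fundOn r1 (isTheta_theta _) a1
  obtain ⟨s2, H2⟩ := r1.fundOn r2 (isTheta_theta _) a2
  obtain ⟨s3, H3⟩ := r2.fundOn r3 (isTheta_theta _) a3
  have hf0 : f0 0 ≠ 0 := fun h => h0 (Fin.ext (by simpa [h] using r0.apply 0))
  rcases H1.isBackShift_or_isRiseFall H2 (r0.avoidsOn a0) (r1.avoidsOn a1) (r2.avoidsOn a2) hf0 hm
    with ⟨hC, hC'⟩ | ⟨k, hk, hkm, hW⟩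
  · left
    apply theta_injective
    apply theta_injective
    rw [theta_swap (by omega), theta_shift (by omega)]
    refine r2.eq avoidsOn_backShiftWord.represents fun i hi => ?_
    rcases i with _ | i
    · exact hC
    · exact hC' i (by omega)
  · right
    obtain rfl | hk : k = 1 ∨ 2 ≤ k := by omega
    · apply theta_injective
      apply theta_injective
      rw [theta_doubleShift (by omega), theta_swap (by omega)]
      refine r2.eq avoidsOn_shiftWord.represents fun i hi => ?_
      have h1 := hW.1 i
      have h2 := hW.2 i hi
      unfold shiftWord
      split_ifs <;> omega
    · exact (H3.not_isRiseFall hm hk hkm hW (r2.avoidsOn a2) (r3.avoidsOn a3)).elim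

theorem swap_apply_zero (hm : 1 ≤ m) : permOfFun m (swapWord m) 0 ≠ 0 := by
  have h := (avoidsOn_swapWord hm).represents.apply 0
  intro h0
  simp [h0, swapWord] at h
  omega

theorem doubleShift_apply_zero (hm : 2 ≤ m) : permOfFun m (doubleShiftWord m) 0 ≠ 0 := by
  have h := (avoidsOn_doubleShiftWord hm).represents.apply 0
  intro h0
  simp [h0, doubleShiftWord] at h
  omega

theorem swap_ne_doubleShift (hm : 4 ≤ m) :
    permOfFun m (swapWord m) ≠ permOfFun m (doubleShiftWord m) := fun h =>
  swap_notMem hm (h ▸ doubleShift_mem (by omega))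

theorem irreducible_three (hm : 4 ≤ m) : {π ∈ thetaAvoiders (m + 1) 3 | π 0 ≠ 0} =
    {permOfFun m (swapWord m), permOfFun m (doubleShiftWord m)} := by
  ext π
  refine ⟨fun h => eq_of_mem_of_apply_zero_ne_zero hm h.1 h.2, ?_⟩
  rintro (rfl | rfl)
  · exact ⟨swap_mem (by omega), swap_apply_zero (by omega)⟩
  · exact ⟨thetaAvoiders_anti (by omega) (doubleShift_mem (by omega)),
      doubleShift_apply_zero (by omega)⟩

theorem irreducible_four (hm : 4 ≤ m) : {π ∈ thetaAvoiders (m + 1) 4 | π 0 ≠ 0} =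
    {permOfFun m (doubleShiftWord m)} := by
  ext π
  constructor
  · rintro ⟨h, h0⟩
    rcases eq_of_mem_of_apply_zero_ne_zero hm (thetaAvoiders_anti (by omega) h) h0 with rfl | rfl
    · exact (swap_notMem hm h).elim
    · rfl
  · rintro rfl
    exact ⟨doubleShift_mem (by omega), doubleShift_apply_zero (by omega)⟩

theorem irreducible_of_five_le (hm : 4 ≤ m) {k : ℕ} (hk : 5 ≤ k) :
    {π ∈ thetaAvoiders (m + 1) k | π 0 ≠ 0} = ∅ := by
  rw [Set.eq_empty_iff_forall_notMem]
  rintro π ⟨h, h0⟩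
  have h4 : π ∈ {π ∈ thetaAvoiders (m + 1) 4 | π 0 ≠ 0} :=
    ⟨thetaAvoiders_anti (by omega) h, h0⟩
  rw [irreducible_four hm, Set.mem_singleton_iff] at h4
  exact doubleShift_notMem hm (h4 ▸ thetaAvoiders_anti hk h)

end Irreducible

section Prepend

variable {n : ℕ}

/-- The direct sum `1 ⊕ σ`. -/
def prepend (σ : Equiv.Perm (Fin n)) : Equiv.Perm (Fin (n + 1)) :=
  Equiv.Perm.decomposeFin.symm (0, σ)

@[simp] theorem prepend_zero (σ : Equiv.Perm (Fin n)) : prepend σ 0 = 0 := by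
  simp [prepend]

@[simp] theorem prepend_succ (σ : Equiv.Perm (Fin n)) (i : Fin n) :
    prepend σ i.succ = (σ i).succ := by
  simp [prepend]

theorem prepend_injective : Function.Injective (prepend (n := n)) := fun σ τ h => by
  simpa [prepend] using h

theorem exists_prepend_eq {π : Equiv.Perm (Fin (n + 1))} (h : π 0 = 0) : ∃ σ, prepend σ = π := by
  obtain ⟨⟨p, σ⟩, rfl⟩ := Equiv.Perm.decomposeFin.symm.surjective π
  rw [Equiv.Perm.decomposeFin_symm_apply_zero] at h
  exact ⟨σ, by rw [h]; rfl⟩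

theorem avoids213_prepend {σ : Equiv.Perm (Fin n)} : Avoids213 (prepend σ) ↔ Avoids213 σ := by
  simp [Avoids213, Fin.forall_fin_succ]

theorem theta_prepend (σ : Equiv.Perm (Fin n)) : theta (prepend σ) = prepend (theta σ) := by
  rw [theta_eq_iff]
  have h := isTheta_theta σ
  generalize theta σ = τ at h
  intro i
  refine Fin.cases ?_ (fun i => ?_) i
  · right
    refine ⟨fun j hj l hl => ?_, 0, le_rfl, by simp, fun l hl => ?_⟩
    · rw [Fin.le_zero_iff.1 hl]
      obtain ⟨j, rfl⟩ := Fin.exists_succ_eq.2 (show j ≠ 0 by rintro rfl; simp at hj)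
      simp
    · rw [Fin.le_zero_iff.1 hl]
  · rcases h i with ⟨j, hj, ⟨l, hl, hlt⟩, he⟩ | ⟨hj, l, hl, he, hmax⟩
    · exact Or.inl ⟨j.succ, by simp [hj], ⟨l.succ, by simpa using hl, by simpa using hlt⟩,
        by simp [he]⟩
    · refine Or.inr ⟨fun j' hj' l' hl' => ?_, l.succ, by simpa using hl, by simp [he],
        fun l' hl' => ?_⟩
      · obtain ⟨j', rfl⟩ := Fin.exists_succ_eq.2 (show j' ≠ 0 by rintro rfl; simp at hj')
        induction l' using Fin.cases with
        | zero => simp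
        | succ l' =>
          simpa using hj j' (by simpa using hj') l' (by simpa using hl')
      · induction l' using Fin.cases with
        | zero => simp
        | succ l' => simpa using hmax l' (by simpa using hl')

theorem prepend_mem_thetaAvoiders {k : ℕ} {σ : Equiv.Perm (Fin n)} :
    prepend σ ∈ thetaAvoiders (n + 1) k ↔ σ ∈ thetaAvoiders n k := by
  induction k generalizing σ with
  | zero => rw [mem_thetaAvoiders_zero, mem_thetaAvoiders_zero, avoids213_prepend]
  | succ k ih =>
    rw [mem_thetaAvoiders_succ, mem_thetaAvoiders_succ, avoids213_prepend, theta_prepend, ih]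

theorem ncard_thetaAvoiders_succ (n k : ℕ) : (thetaAvoiders (n + 1) k).ncard =
    (thetaAvoiders n k).ncard + {π ∈ thetaAvoiders (n + 1) k | π 0 ≠ 0}.ncard := by
  rw [← Set.ncard_image_of_injective (thetaAvoiders n k) prepend_injective,
    ← Set.ncard_union_eq]
  · congr 1
    ext π
    constructor
    · intro h
      by_cases h0 : π 0 = 0
      · obtain ⟨σ, rfl⟩ := exists_prepend_eq h0
        exact Or.inl ⟨σ, prepend_mem_thetaAvoiders.1 h, rfl⟩
      · exact Or.inr ⟨h, h0⟩
    · rintro (⟨σ, h, rfl⟩ | h)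
      · exact prepend_mem_thetaAvoiders.2 h
      · exact h.1
  · rw [Set.disjoint_left]
    rintro _ ⟨σ, _, rfl⟩ h
    exact h.2 (prepend_zero σ)

end Prepend

theorem ncard_thetaAvoiders_three {n : ℕ} (hn : 4 ≤ n) :
    (thetaAvoiders n 3).ncard = 2 * n + 1 := by
  induction n, hn using Nat.le_induction with
  | base => exact ncard_thetaAvoiders_four_three
  | succ n hn ih =>
    rw [ncard_thetaAvoiders_succ, ih, irreducible_three hn,
      Set.ncard_pair (swap_ne_doubleShift hn)]
    ring

theorem ncard_thetaAvoiders_four' {n : ℕ} (hn : 4 ≤ n) :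
    (thetaAvoiders n 4).ncard = n + 4 := by
  induction n, hn using Nat.le_induction with
  | base => exact ncard_thetaAvoiders_four_four
  | succ n hn ih =>
    rw [ncard_thetaAvoiders_succ, ih, irreducible_four hn, Set.ncard_singleton]

theorem ncard_thetaAvoiders_of_five_le {n k : ℕ} (hn : 4 ≤ n) (hk : 5 ≤ k) :
    (thetaAvoiders n k).ncard = 7 := by
  induction n, hn using Nat.le_induction with
  | base => exact ncard_thetaAvoiders_four hk
  | succ n hn ih =>
    rw [ncard_thetaAvoiders_succ, ih, irreducible_of_five_le hn hk, Set.ncard_empty]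

theorem card_avoids_p213 (n k : ℕ) :
    Nat.card {π : Equiv.Perm (Fin n) // ∀ i ≤ k, Avoids (theta^[i] π) p213} =
      (thetaAvoiders n k).ncard := by
  simp only [avoids_p213_iff]
  exact Nat.card_coe_set_eq (thetaAvoiders n k)

/-- for `n ≥ 5`, `t_n^3(213) = 2n+1`, `t_n^4(213) = n+4`, and
`t_n^k(213) = 7` for all `k ≥ 5`. -/
theorem tk_n_213 (n : ℕ) (hn : 5 ≤ n) :
    Nat.card {π : Equiv.Perm (Fin n) // ∀ i ≤ 3, Avoids (theta^[i] π) p213} = 2 * n + 1 ∧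
    Nat.card {π : Equiv.Perm (Fin n) // ∀ i ≤ 4, Avoids (theta^[i] π) p213} = n + 4 ∧
    ∀ k : ℕ, 5 ≤ k →
      Nat.card {π : Equiv.Perm (Fin n) // ∀ i ≤ k, Avoids (theta^[i] π) p213} = 7 := by
  simp only [card_avoids_p213]
  exact ⟨ncard_thetaAvoiders_three (by omega), ncard_thetaAvoiders_four' (by omega),
    fun k hk => ncard_thetaAvoiders_of_five_le (by omega) hk⟩
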